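/- Let (S, R) be an approximation space. For any A, B ⊆ S there exists D ⊆ S such that D^l = A^l ∪ B^l and D^u = A^u ∪ B^u. (This realizability is what makes the join operation on rough equivalence classes, and hence the concrete enriched pre-rough algebra, well defined.) -/

import Mathlib

/-- Lower approximation in an approximation space (S, R). -/
def lap {S : Type*} (R : S → S → Prop) (A : Set S) : Set S :=
  {x | ∀ y, R x y → y ∈ A}

/-- Upper approximation in an approximation space (S, R). -/
def uap {S : Type*} (R : S → S → Prop) (A : Set S) : Set S :=
  {x | ∃ y, R x y ∧ y ∈ A}

/-- The lower approximation is a union of equivalence classes. -/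
theorem mem_lap_congr {S : Type*} {R : S → S → Prop} (hR : Equivalence R) (A : Set S) {x y : S}
    (h : R x y) : x ∈ lap R A ↔ y ∈ lap R A :=
  ⟨fun hx z hz => hx z (hR.trans h hz), fun hy z hz => hy z (hR.trans (hR.symm h) hz)⟩

/-- The upper approximation is a union of equivalence classes. -/
theorem mem_uap_congr {S : Type*} {R : S → S → Prop} (hR : Equivalence R) (A : Set S) {x y : S}
    (h : R x y) : x ∈ uap R A ↔ y ∈ uap R A :=
  ⟨fun ⟨z, hz, hA⟩ => ⟨z, hR.trans (hR.symm h) hz, hA⟩, fun ⟨z, hz, hA⟩ => ⟨z, hR.trans h hz, hA⟩⟩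

theorem stmt11 {S : Type*} (R : S → S → Prop) (hR : Equivalence R)
    (A B : Set S) :
    ∃ D : Set S, lap R D = lap R A ∪ lap R B ∧ uap R D = uap R A ∪ uap R B := by
  -- On a class meeting `A` but not contained in `B`, the witness agrees with `A`.
  refine ⟨A ∪ {x | x ∈ B ∧ (x ∈ lap R B ∨ x ∉ uap R A)}, ?_, ?_⟩
  · ext x
    constructor
    · intro hx
      by_cases hB : x ∈ lap R B
      · exact Or.inr hB
      by_cases hA : x ∈ uap R A
      · refine Or.inl fun y hy => (hx y hy).resolve_right ?_
        rintro ⟨-, h | h⟩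
        · exact hB ((mem_lap_congr hR B hy).2 h)
        · exact h ((mem_uap_congr hR A hy).1 hA)
      · exact Or.inr fun y hy => (hx y hy).elim (fun h => (hA ⟨y, hy, h⟩).elim) And.left
    · rintro (h | h) y hy
      · exact Or.inl (h y hy)
      · exact Or.inr ⟨h y hy, Or.inl ((mem_lap_congr hR B hy).1 h)⟩
  · ext x
    constructor
    · rintro ⟨y, hy, h | h⟩
      · exact Or.inl ⟨y, hy, h⟩
      · exact Or.inr ⟨y, hy, h.1⟩
    · rintro (⟨y, hy, h⟩ | ⟨y, hy, h⟩)
      · exact ⟨y, hy, Or.inl h⟩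
      · by_cases hA : x ∈ uap R A
        · obtain ⟨z, hz, hzA⟩ := hA
          exact ⟨z, hz, Or.inl hzA⟩
        · exact ⟨y, hy, Or.inr ⟨h, Or.inr fun hyA => hA ((mem_uap_congr hR A hy).2 hyA)⟩⟩
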